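/- For any integer l ≥ 6, there exists a port-labeled graph on (l+2)·2^l nodes with at most 2^{2l} edges and diameter at most 3 containing two nodes a, b whose infinite views are distinct but whose views truncated to depth l−1 are identical. -/

import Mathlib

/-- A port-labeled network: each node `v` has degree `deg v`, and for each port
`p ∈ {1,…,deg v}`, `next v p` is the neighbor reached via port `p` and `ret v p`
is the port number of the same edge at that neighbor (i.e. `end(v,p) = λ(next(v,p), v)`). -/
structure PortNetwork (V : Type*) where
  deg : V → ℕ
  next : V → ℕ → V
  ret : V → ℕ → ℕ

/-- Coherence of a port network: following a valid port and then the corresponding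
return port leads back, with matching labels. -/
def PortNetwork.Coherent {V : Type*} (N : PortNetwork V) : Prop :=
  ∀ v p, 1 ≤ p → p ≤ N.deg v →
    1 ≤ N.ret v p ∧ N.ret v p ≤ N.deg (N.next v p) ∧
      N.next (N.next v p) (N.ret v p) = v ∧ N.ret (N.next v p) (N.ret v p) = p

/-- Trees with edges labeled by pairs of port numbers: the datatype of (truncated) views. -/
inductive ViewTree : Type
  | node : List (ℕ × ℕ × ViewTree) → ViewTree

/-- The view of node `v` truncated to depth `k`: the root has one child per port
`p ∈ {1,…,deg v}`, the corresponding edge carrying the label pair `(p, end(v,p))`,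
and the child subtree is the view of `next v p` truncated to depth `k-1`. -/
def view {V : Type*} (N : PortNetwork V) : ℕ → V → ViewTree
  | 0, _ => ViewTree.node []
  | k + 1, v => ViewTree.node
      ((List.range (N.deg v)).map fun t =>
        (t + 1, N.ret v (t + 1), view N k (N.next v (t + 1))))

/-- A list of ports is a valid walk from `v` if each successive port is legal
at the node reached so far. -/
def ValidWalk {V : Type*} (N : PortNetwork V) : V → List ℕ → Prop
  | _, [] => True
  | v, p :: ps => 1 ≤ p ∧ p ≤ N.deg v ∧ ValidWalk N (N.next v p) ps

/-- The endpoint of the walk from `v` following the given list of ports. -/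
def walkEnd {V : Type*} (N : PortNetwork V) : V → List ℕ → V
  | v, [] => v
  | v, p :: ps => walkEnd N (N.next v p) ps

/-- The signature of a walk: the list of pairs (outgoing port, incoming port at the
other end) of the successively traversed edges. Two walks are isomorphic iff their
signatures are equal. -/
def walkSig {V : Type*} (N : PortNetwork V) : V → List ℕ → List (ℕ × ℕ)
  | _, [] => []
  | v, p :: ps => (p, N.ret v p) :: walkSig N (N.next v p) ps

/-- Bit vectors of length `n + 1`. -/
abbrev GlX (n : ℕ) : Type := Fin (n + 1) → ZMod 2

/-- Ports of a hub: translations, links to leaves, transports, observation ports. -/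
abbrev GlQ (n : ℕ) : Type := (GlX n ⊕ Fin (n + 2)) ⊕ (Fin (n + 1) ⊕ ZMod 2)

/-- Nodes: hubs `(x, none)` and leaves `(x, some i)`. -/
abbrev GlV (n : ℕ) : Type := GlX n × Option (Fin (n + 2))

/-- Add coordinate `i` to coordinate `i + 1`. -/
def glTr {n : ℕ} (i : Fin (n + 1)) (x : GlX n) : GlX n :=
  fun j => if j.val = i.val + 1 then x j + x i else x j

lemma glTr_invol {n : ℕ} (i : Fin (n + 1)) (x : GlX n) : glTr i (glTr i x) = x := by
  funext j
  by_cases h : j.val = i.val + 1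
  · simp [glTr, h, add_assoc, CharTwo.add_self_eq_zero]
  · simp [glTr, h]

def glAct {n : ℕ} (x : GlX n) : GlQ n → GlV n
  | .inl (.inl c) => (x + c, none)
  | .inl (.inr i) => (x, some i)
  | .inr (.inl i) => (glTr i x, none)
  | .inr (.inr _) => (x, none)

noncomputable def glCode {n : ℕ} (q : GlQ n) : ℕ := (Fintype.equivFin (GlQ n) q).val + 1

noncomputable def glDec {n : ℕ} (p : ℕ) : GlQ n :=
  if h : p - 1 < Fintype.card (GlQ n) then (Fintype.equivFin (GlQ n)).symm ⟨p - 1, h⟩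
  else .inr (.inr 0)

lemma glDec_code {n : ℕ} (q : GlQ n) : glDec (glCode q) = q := by
  simp [glDec, glCode, -Fintype.card_sum]

lemma glCode_le {n : ℕ} (q : GlQ n) : glCode q ≤ Fintype.card (GlQ n) :=
  (Fintype.equivFin (GlQ n) q).isLt

lemma glCode_pos {n : ℕ} (q : GlQ n) : 1 ≤ glCode q := Nat.succ_le_succ (Nat.zero_le _)

lemma glCode_dec {n : ℕ} (p : ℕ) (h1 : 1 ≤ p) (h2 : p ≤ Fintype.card (GlQ n)) :
    glCode (glDec (n := n) p) = p := by
  have h : p - 1 < Fintype.card (GlQ n) := by omega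
  rw [glDec, dif_pos h, glCode, Equiv.apply_symm_apply]
  simp only
  omega

noncomputable def glRet {n : ℕ} (x : GlX n) : GlQ n → ℕ
  | .inl (.inl c) => glCode (n := n) (.inl (.inl c))
  | .inl (.inr _) => 1
  | .inr (.inl i) => glCode (n := n) (.inr (.inl i))
  | .inr (.inr b) => glCode (n := n) (.inr (.inr (b + x (Fin.last n))))

noncomputable def glN (n : ℕ) : PortNetwork (GlV n) where
  deg v := match v.2 with
    | none => Fintype.card (GlQ n)
    | some _ => 1
  next v p := match v.2 with
    | none => glAct v.1 (glDec p)
    | some _ => (v.1, none)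
  ret v p := match v.2 with
    | none => glRet v.1 (glDec p)
    | some i => glCode (n := n) (.inl (.inr i))

section
variable {n : ℕ}

lemma glN_deg_none (x : GlX n) : (glN n).deg (x, none) = Fintype.card (GlQ n) := rfl
lemma glN_deg_some (x : GlX n) (i) : (glN n).deg (x, some i) = 1 := rfl
lemma glN_next_none (x : GlX n) (p) : (glN n).next (x, none) p = glAct x (glDec p) := rfl
lemma glN_next_some (x : GlX n) (i p) : (glN n).next (x, some i) p = (x, none) := rfl
lemma glN_ret_none (x : GlX n) (p) : (glN n).ret (x, none) p = glRet x (glDec p) := rfl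
lemma glN_ret_some (x : GlX n) (i p) :
    (glN n).ret (x, some i) p = glCode (n := n) (.inl (.inr i)) := rfl

lemma glN_coherent : (glN n).Coherent := by
  rintro ⟨x, _ | i⟩ p h1 h2
  · rw [glN_deg_none] at h2
    have hp := glCode_dec p h1 h2
    rw [glN_next_none, glN_ret_none]
    generalize glDec p = q at hp
    subst hp
    rcases q with (c | i) | (i | b)
    · simp only [glAct, glRet, glN_deg_none, glN_next_none, glN_ret_none, glDec_code]
      refine ⟨glCode_pos _, glCode_le _, ?_, trivial⟩
      rw [add_assoc, CharTwo.add_self_eq_zero, add_zero]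
    · exact ⟨le_rfl, le_rfl, rfl, rfl⟩
    · simp only [glAct, glRet, glN_deg_none, glN_next_none, glN_ret_none, glDec_code, glTr_invol]
      exact ⟨glCode_pos _, glCode_le _, trivial, trivial⟩
    · simp only [glAct, glRet, glN_deg_none, glN_next_none, glN_ret_none, glDec_code]
      refine ⟨glCode_pos _, glCode_le _, trivial, ?_⟩
      rw [add_assoc, CharTwo.add_self_eq_zero, add_zero]
  · rw [glN_deg_some] at h2
    have : p = 1 := by omega
    subst this
    simp only [glN_next_some, glN_ret_some, glN_deg_none, glN_next_none, glN_ret_none, glDec_code]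
    exact ⟨glCode_pos _, glCode_le _, rfl, rfl⟩

lemma gl_view_eq (k : ℕ) : ∀ (x y : GlX n) (z : Option (Fin (n + 2))),
    (∀ j : Fin (n + 1), n + 1 ≤ j.val + k → x j = y j) →
    view (glN n) k (x, z) = view (glN n) k (y, z) := by
  induction k with
  | zero => intros; rfl
  | succ k ih =>
    intro x y z h
    have h' : ∀ j : Fin (n + 1), n + 1 ≤ j.val + k → x j = y j := fun j hj => h j (by omega)
    rcases z with _ | i
    · simp only [view, glN_deg_none, glN_next_none, glN_ret_none]
      congr 1
      apply List.map_congr_left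
      intro t _
      generalize glDec (n := n) (t + 1) = q
      rcases q with (c | i) | (i | b)
      · simp only [glAct, glRet]
        rw [ih (x + c) (y + c) none]
        intro j hj
        simp [h' j hj]
      · simp only [glAct, glRet]
        rw [ih x y (some i) h']
      · simp only [glAct, glRet]
        rw [ih (glTr i x) (glTr i y) none]
        intro j hj
        simp only [glTr]
        split_ifs with hji
        · rw [h' j hj, h i (by omega)]
        · exact h' j hj
      · simp only [glAct, glRet]
        rw [ih x y none h', h (Fin.last n) (by simp)]
    · simp only [view, glN_deg_some, glN_next_some, glN_ret_some]
      rw [ih x y none h']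

lemma gl_view_port (k : ℕ) (x y : GlX n)
    (h : view (glN n) (k + 1) (x, none) = view (glN n) (k + 1) (y, none)) (q : GlQ n) :
    glRet x q = glRet y q ∧ view (glN n) k (glAct x q) = view (glN n) k (glAct y q) := by
  simp only [view, glN_deg_none, glN_next_none, glN_ret_none, ViewTree.node.injEq] at h
  have h2 := List.map_inj_left.1 h (glCode q - 1)
    (List.mem_range.2 (by have := glCode_le q; have := glCode_pos q; omega))
  rw [Nat.sub_add_cancel (glCode_pos q), glDec_code] at h2
  simpa using h2

lemma gl_code_inj {q r : GlQ n} (h : glCode q = glCode r) : q = r := by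
  rw [← glDec_code q, h, glDec_code]

lemma gl_view_sep (k : ℕ) : ∀ (x y : GlX n),
    view (glN n) k (x, none) = view (glN n) k (y, none) →
    ∀ j : Fin (n + 1), n + 1 ≤ j.val + k → x j = y j := by
  induction k with
  | zero => intro x y _ j hj; omega
  | succ k ih =>
    intro x y h j hj
    by_cases hjl : j.val = n
    · have := (gl_view_port k x y h (.inr (.inr 0))).1
      have := gl_code_inj this
      have hj' : j = Fin.last n := Fin.ext hjl
      subst hj'
      simpa using this
    · have hlt : j.val + 1 < n + 1 := by omega
      have e1 := ih _ _ (gl_view_port k x y h (.inl (.inl 0))).2 ⟨j.val + 1, hlt⟩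
        (by simp only; omega)
      have e2 := ih _ _ (gl_view_port k x y h (.inr (.inl j))).2 ⟨j.val + 1, hlt⟩
        (by simp only; omega)
      simp [glTr] at e1 e2
      rw [e1] at e2
      exact add_left_cancel e2

lemma gl_hub_step (x : GlX n) (q : GlQ n) :
    1 ≤ glCode q ∧ glCode q ≤ (glN n).deg (x, none) ∧
      (glN n).next (x, none) (glCode q) = glAct x q :=
  ⟨glCode_pos q, glCode_le q, by rw [glN_next_none, glDec_code]⟩

lemma gl_from_hub (x y : GlX n) (z : Option (Fin (n + 2))) :
    ∃ ps : List ℕ, ValidWalk (glN n) (x, none) ps ∧ ps.length ≤ 2 ∧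
      walkEnd (glN n) (x, none) ps = (y, z) := by
  obtain ⟨a1, a2, a3⟩ := gl_hub_step x (.inl (.inl (y - x)))
  have a4 : glAct x (.inl (.inl (y - x))) = (y, none) := by simp [glAct]
  rw [a4] at a3
  rcases z with _ | i
  · exact ⟨[_], ⟨a1, a2, trivial⟩, by simp, a3⟩
  · obtain ⟨b1, b2, b3⟩ := gl_hub_step y (.inl (.inr i))
    refine ⟨[_, glCode (n := n) (.inl (.inr i))], ⟨a1, a2, ?_⟩, by simp, ?_⟩
    · rw [a3]; exact ⟨b1, b2, trivial⟩
    · simp only [walkEnd]; rw [a3, b3]; rfl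

lemma gl_diam (u v : GlV n) : ∃ ps : List ℕ, ValidWalk (glN n) u ps ∧ ps.length ≤ 3 ∧
    walkEnd (glN n) u ps = v := by
  obtain ⟨x, z⟩ := u
  obtain ⟨y, w⟩ := v
  obtain ⟨ps, h1, h2, h3⟩ := gl_from_hub x y w
  rcases z with _ | i
  · exact ⟨ps, h1, by omega, h3⟩
  · exact ⟨1 :: ps, ⟨le_rfl, le_rfl, h1⟩, by simp; omega, h3⟩

lemma gl_pow (n : ℕ) (hn : 5 ≤ n) : 3 * n + 7 ≤ 2 ^ (n + 1) := by
  induction n, hn using Nat.le_induction with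
  | base => norm_num
  | succ m hm ih => rw [pow_succ]; omega

lemma gl_sum (hn : 5 ≤ n) : (∑ v : GlV n, (glN n).deg v) ≤ 2 * 2 ^ (2 * (n + 1)) := by
  rw [Fintype.sum_prod_type]
  simp only [Fintype.sum_option, glN_deg_none, glN_deg_some]
  have := gl_pow n hn
  simp [ZMod.card]
  rw [mul_comm 2 (n + 1), pow_mul]
  nlinarith
end

/-- Proposition 3.1: for every `l ≥ 6` there is a (coherent) port-labeled network on
`(l+2)·2^l` nodes with at most `2^{2l}` edges (i.e. degree sum at most `2·2^{2l}`) and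
diameter at most 3 (every node reaches every other by a walk of length at most 3),
containing two nodes whose views are distinct but agree when truncated to depth `l-1`. -/
theorem exists_Gl (l : ℕ) (hl : 6 ≤ l) :
    ∃ (V : Type) (_ : Fintype V) (N : PortNetwork V), N.Coherent ∧
      Fintype.card V = (l + 2) * 2 ^ l ∧
      (∑ v : V, N.deg v) ≤ 2 * 2 ^ (2 * l) ∧
      (∀ u v : V, ∃ ps : List ℕ, ValidWalk N u ps ∧ ps.length ≤ 3 ∧ walkEnd N u ps = v) ∧
      ∃ a b : V, (∃ k, view N k a ≠ view N k b) ∧ view N (l - 1) a = view N (l - 1) b := by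
  obtain ⟨n, rfl⟩ : ∃ n, l = n + 1 := ⟨l - 1, by omega⟩
  refine ⟨GlV n, inferInstance, glN n, glN_coherent, ?_, gl_sum (by omega), gl_diam,
    (0, none), (Pi.single 0 1, none), ⟨n + 1, ?_⟩, ?_⟩
  · simp [ZMod.card]; ring
  · intro h
    have := gl_view_sep (n + 1) _ _ h 0 (by omega)
    simp at this
  · apply gl_view_eq
    intro j hj
    have : j ≠ 0 := by rintro rfl; simp at hj
    simp [this]
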